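/- arXiv:1811.05428 — 6 statements merged into one kernel-verified Lean document; each statement's English description precedes it below -/
import Mathlib

section
/- Let λ, μ be positive real numbers with μ − λ < 2, and let ψ, χ be holomorphic functions on 𝔻. Suppose there exists a constant C > 0 such that for every f ∈ H^{(λ)}, the function ψ f′ + χ f belongs to H^{(μ)} and ‖ψ f′ + χ f‖_{H^{(μ)}} ≤ C ‖f‖_{H^{(λ)}}. Then ψ is identically zero on 𝔻. -/
open Metric

/-- The Pochhammer symbol `(l)ₙ = l (l+1) ⋯ (l+n−1)`. -/
noncomputable def poch (l : ℝ) (n : ℕ) : ℝ := ∏ i ∈ Finset.range n, (l + i)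

/-- The weight `n! / (l)ₙ`, i.e. `‖zⁿ‖²` in the space `H^{(l)}` with kernel `(1 - z w̄)^{-l}`. -/
noncomputable def wt (l : ℝ) (n : ℕ) : ℝ := (Nat.factorial n : ℝ) / poch l n

open Filter Topology

/-- Power series coefficients are determined by the sum near `0`, up to a shift by `z ^ n`. -/
theorem coeff_eq_of_hasSum_shift {β γ : ℕ → ℂ} {F : ℂ → ℂ} (n : ℕ)
    (hβ : ∀ᶠ z in 𝓝 (0 : ℂ), HasSum (fun j => β j * z ^ j) (z ^ n * F z))
    (hγ : ∀ᶠ z in 𝓝 (0 : ℂ), HasSum (fun k => γ k * z ^ k) (F z)) (k : ℕ) :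
    β (k + n) = γ k := by
  let δ : ℕ → ℂ := fun j => if n ≤ j then γ (j - n) else 0
  have hδ : ∀ᶠ z in 𝓝 (0 : ℂ), HasSum (fun j => δ j * z ^ j) (z ^ n * F z) := by
    filter_upwards [hγ] with z hz
    rw [← (add_left_injective n).hasSum_iff]
    · refine (hz.mul_left (z ^ n)).congr_fun ?_
      intro j
      simp [δ, pow_add]
      ring
    · intro j hj
      have : ¬ n ≤ j := fun h => hj ⟨j - n, by simp [h]⟩
      simp [δ, this]
  have hp : HasFPowerSeriesAt (fun z => z ^ n * F z)
      (FormalMultilinearSeries.ofScalars ℂ β) 0 := by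
    rw [hasFPowerSeriesAt_iff]
    filter_upwards [hβ] with z hz
    simpa [mul_comm] using hz
  have hq : HasFPowerSeriesAt (fun z => z ^ n * F z)
      (FormalMultilinearSeries.ofScalars ℂ δ) 0 := by
    rw [hasFPowerSeriesAt_iff]
    filter_upwards [hδ] with z hz
    simpa [mul_comm] using hz
  have h := congrArg (fun p => p.coeff (k + n)) (hp.eq_formalMultilinearSeries hq)
  simpa [δ] using h

theorem poch_pos {l : ℝ} (hl : 0 < l) (n : ℕ) : 0 < poch l n :=
  Finset.prod_pos fun i _ => by positivity

theorem wt_pos {l : ℝ} (hl : 0 < l) (n : ℕ) : 0 < wt l n :=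
  div_pos (by positivity) (poch_pos hl n)

/-- `n! / (l)ₙ` is asymptotic to `Γ(l) n ^ (1 - l)`. -/
theorem tendsto_wt_mul_rpow {l : ℝ} :
    Tendsto (fun n : ℕ => wt l n * (n : ℝ) ^ (l - 1)) atTop (𝓝 (Real.Gamma l)) := by
  rw [← tendsto_add_atTop_iff_nat 1]
  have h1 : Tendsto (fun n : ℕ => ((n + 1 : ℝ) / n) ^ l) atTop (𝓝 1) := by
    have h : Tendsto (fun n : ℕ => ((n + 1 : ℝ) / n)) atTop (𝓝 1) := by
      simpa [add_comm] using tendsto_add_mul_div_add_mul_atTop_nhds (1 : ℝ) 0 1 one_ne_zero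
    simpa using h.rpow_const (p := l) (Or.inl one_ne_zero)
  have h2 := (Real.GammaSeq_tendsto_Gamma l).mul h1
  rw [mul_one] at h2
  refine h2.congr' ?_
  filter_upwards [eventually_gt_atTop 0] with n hn
  have hn' : (0 : ℝ) < n := by exact_mod_cast hn
  have e : (n : ℝ) ^ l ≠ 0 := (Real.rpow_pos_of_pos hn' l).ne'
  rw [Real.div_rpow (by positivity) hn'.le, Real.GammaSeq, wt, poch]
  push_cast [Nat.factorial_succ]
  rw [Real.rpow_sub_one (by positivity)]
  field_simp

theorem tendsto_wt_ratio {l m : ℝ} (hm : 0 < m) (hlm : m - l < 2) (k : ℕ) :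
    Tendsto (fun n : ℕ => wt l (n + 1) / (wt m (k + n) * ((n : ℝ) + 1) ^ 2)) atTop (𝓝 0) := by
  have h1 := (tendsto_add_atTop_iff_nat 1).2 (tendsto_wt_mul_rpow (l := l))
  have h2 := ((tendsto_add_atTop_iff_nat k).2 (tendsto_wt_mul_rpow (l := m)))
  have h3 : Tendsto (fun n : ℕ => ((n + k : ℝ) / (n + 1)) ^ (m - 1)) atTop (𝓝 1) := by
    have h : Tendsto (fun n : ℕ => ((n + k : ℝ) / (n + 1))) atTop (𝓝 1) := by
      simpa [add_comm] using tendsto_add_mul_div_add_mul_atTop_nhds (k : ℝ) 1 1 one_ne_zero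
    simpa using h.rpow_const (p := m - 1) (Or.inl one_ne_zero)
  have h4 : Tendsto (fun n : ℕ => ((n + 1 : ℕ) : ℝ) ^ (-(2 - (m - l)))) atTop (𝓝 0) :=
    (tendsto_rpow_neg_atTop (by linarith)).comp
      (tendsto_natCast_atTop_atTop.comp (tendsto_add_atTop_nat 1))
  have h5 := ((h1.div h2 (Real.Gamma_pos_of_pos hm).ne').mul h3).mul h4
  rw [mul_zero] at h5
  refine h5.congr' ?_
  filter_upwards [eventually_gt_atTop 0] with n hn
  have hn' : (0 : ℝ) < n := by exact_mod_cast hn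
  have a : (0 : ℝ) < n + 1 := by positivity
  have b : (0 : ℝ) < n + k := by positivity
  have hw := (wt_pos hm (k + n)).ne'
  have e : ((n : ℝ) + 1) ^ (-(2 - (m - l))) =
      ((n : ℝ) + 1) ^ (m - 1) / ((n : ℝ) + 1) ^ (l - 1) / ((n : ℝ) + 1) ^ 2 := by
    rw [← Real.rpow_sub a, ← Real.rpow_sub_natCast a.ne']
    push_cast
    ring_nf
  have p1 := (Real.rpow_pos_of_pos a (l - 1)).ne'
  have p2 := (Real.rpow_pos_of_pos a (m - 1)).ne'
  have p3 := (Real.rpow_pos_of_pos b (m - 1)).ne'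
  simp only [Pi.div_apply]
  rw [Real.div_rpow b.le a.le]
  push_cast
  rw [e, add_comm n k]
  generalize ((n : ℝ) + 1) ^ (l - 1) = x at *
  generalize ((n : ℝ) + 1) ^ (m - 1) = y at *
  generalize ((n : ℝ) + k) ^ (m - 1) = t at *
  field_simp

/-- Let `λ, μ > 0` with `μ − λ < 2` and let `ψ, χ` be holomorphic on the unit
disc. If there is `C > 0` such that for every `f ∈ H^{(λ)}` the function `ψ f′ + χ f` belongs to
`H^{(μ)}` with `‖ψ f′ + χ f‖_{H^{(μ)}} ≤ C ‖f‖_{H^{(λ)}}`, then `ψ ≡ 0` on the disc. -/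
theorem stmt_5 (l m : ℝ) (hl : 0 < l) (hm : 0 < m) (hlm : m - l < 2)
    (ψ χ : ℂ → ℂ)
    (hψ : DifferentiableOn ℂ ψ (ball 0 1)) (hχ : DifferentiableOn ℂ χ (ball 0 1))
    (C : ℝ) (hC : 0 < C)
    (hbd : ∀ (f : ℂ → ℂ) (α : ℕ → ℂ),
      (∀ z ∈ ball (0 : ℂ) 1, HasSum (fun n => α n * z ^ n) (f z)) →
      Summable (fun n => ‖α n‖ ^ 2 * wt l n) →
      ∃ β : ℕ → ℂ,
        (∀ z ∈ ball (0 : ℂ) 1,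
          HasSum (fun n => β n * z ^ n) (ψ z * deriv f z + χ z * f z)) ∧
        Summable (fun n => ‖β n‖ ^ 2 * wt m n) ∧
        ∑' n, ‖β n‖ ^ 2 * wt m n ≤ C ^ 2 * ∑' n, ‖α n‖ ^ 2 * wt l n) :
    ∀ z ∈ ball (0 : ℂ) 1, ψ z = 0 := by
  have h0 : (0 : ℂ) ∈ ball (0 : ℂ) 1 := by simp
  have hball : ball (0 : ℂ) 1 ∈ 𝓝 (0 : ℂ) := isOpen_ball.mem_nhds h0
  have hψa := hψ.analyticOnNhd isOpen_ball
  have hXa : AnalyticAt ℂ (fun z => z * χ z) 0 :=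
    analyticAt_id.mul (hχ.analyticOnNhd isOpen_ball 0 h0)
  obtain ⟨p, hp⟩ := hψa 0 h0
  obtain ⟨q, hq⟩ := hXa
  rw [hasFPowerSeriesAt_iff] at hp hq
  simp only [zero_add, smul_eq_mul] at hp hq
  have key : ∀ n k : ℕ,
      ‖p.coeff k + q.coeff k / ((n : ℂ) + 1)‖ ^ 2 ≤
        C ^ 2 * (wt l (n + 1) / (wt m (k + n) * ((n : ℝ) + 1) ^ 2)) := by
    intro n k
    have hα : ∀ j, j ≠ n + 1 → ‖(Pi.single (n + 1) (1 : ℂ) : ℕ → ℂ) j‖ ^ 2 * wt l j = 0 := by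
      intro j hj
      simp [hj]
    obtain ⟨β, hβ, hs, hle⟩ := hbd (fun z => z ^ (n + 1)) (Pi.single (n + 1) 1)
      (fun z _ => by
        have := hasSum_single (f := fun j => (Pi.single (n + 1) (1 : ℂ) : ℕ → ℂ) j * z ^ j)
          (n + 1) (fun j hj => by simp [hj])
        simpa using this)
      (hasSum_single (n + 1) hα).summable
    rw [tsum_eq_single (n + 1) hα] at hle
    have hcoeff : β (k + n) = ((n : ℂ) + 1) * p.coeff k + q.coeff k := by
      refine coeff_eq_of_hasSum_shift (F := fun z => ((n : ℂ) + 1) * ψ z + z * χ z)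
        (γ := fun k => ((n : ℂ) + 1) * p.coeff k + q.coeff k) n ?_ ?_ k
      · filter_upwards [hball] with z hz
        convert hβ z hz using 1
        simp
        ring
      · filter_upwards [hp, hq] with z hz hz'
        refine ((hz.mul_left ((n : ℂ) + 1)).add hz').congr_fun ?_
        intro j
        ring
    have hterm := (hs.le_tsum (k + n) fun j _ =>
      mul_nonneg (sq_nonneg _) (wt_pos hm j).le).trans hle
    have hn : ((n : ℂ) + 1) ≠ 0 := Nat.cast_add_one_ne_zero n
    have hnorm : ‖(n : ℂ) + 1‖ = (n : ℝ) + 1 := by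
      exact_mod_cast Complex.norm_natCast (n + 1)
    have hfac : β (k + n) = ((n : ℂ) + 1) * (p.coeff k + q.coeff k / ((n : ℂ) + 1)) := by
      rw [hcoeff]
      field_simp
    rw [hfac, norm_mul, hnorm] at hterm
    have hw := wt_pos hm (k + n)
    rw [← mul_div_assoc, le_div_iff₀ (by positivity)]
    simp at hterm
    linarith
  have hcoeff : ∀ k, p.coeff k = 0 := by
    intro k
    have h1 : Tendsto (fun n : ℕ => ‖p.coeff k + q.coeff k / ((n : ℂ) + 1)‖ ^ 2) atTop
        (𝓝 (‖p.coeff k‖ ^ 2)) := by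
      have h : Tendsto (fun n : ℕ => q.coeff k / ((n : ℂ) + 1)) atTop (𝓝 0) := by
        have := (tendsto_one_div_add_atTop_nhds_zero_nat (𝕜 := ℂ)).const_mul (q.coeff k)
        simpa [div_eq_mul_inv] using this
      simpa using ((h.const_add (p.coeff k)).norm.pow 2)
    have h2 := (tendsto_wt_ratio hm hlm k).const_mul (C ^ 2)
    rw [mul_zero] at h2
    have h3 := le_of_tendsto_of_tendsto' h1 h2 fun n => key n k
    simpa using le_antisymm h3 (sq_nonneg _)
  have hev : ψ =ᶠ[𝓝 0] 0 := by
    filter_upwards [hp] with z hz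
    simp only [hcoeff, mul_zero] at hz
    exact hz.unique hasSum_zero
  exact fun z hz => hψa.eqOn_zero_of_preconnected_of_eventuallyEq_zero
    (convex_ball 0 1).isPreconnected h0 hev hz
end

section
/- Let c > 0 and let (bₙ)_{n≥0} be a sequence of positive real numbers such that n·bₙ < c for all n ≥ 0 and such that Σ_{n≥0} bₙ xⁿ converges for every x ∈ [0,1). Then for every x ∈ [0,1), Σ_{n≥0} xⁿ (Σ_{j=0}^{n} b_j)² / b_{n+1} ≥ (1/c)·(1−x)^{−2}·(Σ_{n≥0} bₙ xⁿ)², where the left-hand side is allowed to be infinite. -/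
/-- The generating function of the partial sums of `b` is `(1 - x)⁻¹ * ∑ bₙ xⁿ`. -/
lemma hasSum_sum_range_mul_pow {b : ℕ → ℝ} {x : ℝ} (hx : ‖x‖ < 1)
    (h : Summable fun n => ‖b n * x ^ n‖) :
    HasSum (fun n => (∑ j ∈ Finset.range (n + 1), b j) * x ^ n)
      ((1 - x)⁻¹ * ∑' n, b n * x ^ n) := by
  have hg : Summable fun n : ℕ => ‖x ^ n‖ := summable_norm_geometric_of_norm_lt_one hx
  have hprod := hasSum_sum_range_mul_of_summable_norm h hg
  rw [tsum_geometric_of_norm_lt_one hx, mul_comm] at hprod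
  refine hprod.congr_fun fun n => ?_
  rw [Finset.sum_mul]
  refine Finset.sum_congr rfl fun k hk => ?_
  rw [mul_assoc, ← pow_add, Nat.add_sub_cancel' (Finset.mem_range_succ_iff.mp hk)]

/-- The Cauchy square of a power series with nonnegative nondecreasing coefficients `sₙ` has
`n`-th coefficient at most `(n + 1) sₙ²`. -/
lemma Monotone.sum_range_mul_pow_le {s : ℕ → ℝ} (hs : Monotone s) (h0 : ∀ n, 0 ≤ s n)
    {x : ℝ} (hx : 0 ≤ x) (n : ℕ) :
    ∑ k ∈ Finset.range (n + 1), s k * x ^ k * (s (n - k) * x ^ (n - k)) ≤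
      (n + 1) * (x ^ n * s n ^ 2) := by
  have hterm : ∀ k ∈ Finset.range (n + 1),
      s k * x ^ k * (s (n - k) * x ^ (n - k)) ≤ x ^ n * s n ^ 2 := by
    intro k hk
    have hkn : k ≤ n := Finset.mem_range_succ_iff.mp hk
    calc s k * x ^ k * (s (n - k) * x ^ (n - k))
        = x ^ (k + (n - k)) * (s k * s (n - k)) := by rw [pow_add]; ring
      _ = x ^ n * (s k * s (n - k)) := by rw [Nat.add_sub_cancel' hkn]
      _ ≤ x ^ n * (s n * s n) := by
          gcongr
          · exact h0 _
          · exact h0 _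
          · exact hs hkn
          · exact hs (Nat.sub_le n k)
      _ = x ^ n * s n ^ 2 := by ring
  simpa using Finset.sum_le_card_nsmul _ _ _ hterm


/-- Let `c > 0` and `(bₙ)` be positive reals with `n bₙ < c` for all `n`, such
that `Σ bₙ xⁿ` converges for every `x ∈ [0,1)`. Then for every `x ∈ [0,1)`,
`Σₙ xⁿ (Σ_{j≤n} b_j)² / b_{n+1} ≥ (1/c) (1−x)⁻² (Σₙ bₙ xⁿ)²`, the left side computed in `[0,∞]`. -/
theorem stmt_7 (c : ℝ) (hc : 0 < c) (b : ℕ → ℝ) (hb : ∀ n, 0 < b n)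
    (hnb : ∀ n : ℕ, (n : ℝ) * b n < c)
    (hconv : ∀ x ∈ Set.Ico (0 : ℝ) 1, Summable (fun n => b n * x ^ n)) :
    ∀ x ∈ Set.Ico (0 : ℝ) 1,
      ENNReal.ofReal ((1 / c) * ((1 - x)⁻¹) ^ 2 * (∑' n, b n * x ^ n) ^ 2) ≤
        ∑' n, ENNReal.ofReal (x ^ n * (∑ j ∈ Finset.range (n + 1), b j) ^ 2 / b (n + 1)) := by
  rintro x ⟨hx0, hx1⟩
  have hxn : ‖x‖ < 1 := by rwa [Real.norm_of_nonneg hx0]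
  set s : ℕ → ℝ := fun n => ∑ j ∈ Finset.range (n + 1), b j with hs
  have hs0 : ∀ n, 0 ≤ s n := fun n => Finset.sum_nonneg fun j _ => (hb j).le
  have hmono : Monotone s := monotone_nat_of_le_succ fun n => by
    simp only [hs]
    rw [Finset.sum_range_succ _ (n + 1)]
    exact le_add_of_nonneg_right (hb _).le
  have hsum := hasSum_sum_range_mul_pow hxn (hconv x ⟨hx0, hx1⟩).norm
  have hsq := hasSum_sum_range_mul_of_summable_norm hsum.summable.norm hsum.summable.norm
  rw [hsum.tsum_eq] at hsq
  have hscaled := hsq.mul_left (1 / c)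
  have hnonneg : ∀ n, 0 ≤ 1 / c *
      ∑ k ∈ Finset.range (n + 1), s k * x ^ k * (s (n - k) * x ^ (n - k)) := fun n =>
    mul_nonneg (by positivity) (Finset.sum_nonneg fun k _ =>
      mul_nonneg (mul_nonneg (hs0 _) (pow_nonneg hx0 _)) (mul_nonneg (hs0 _) (pow_nonneg hx0 _)))
  rw [show 1 / c * (1 - x)⁻¹ ^ 2 * (∑' n, b n * x ^ n) ^ 2 =
      1 / c * ((1 - x)⁻¹ * (∑' n, b n * x ^ n) * ((1 - x)⁻¹ * ∑' n, b n * x ^ n)) by ring,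
    ← hscaled.tsum_eq, ENNReal.ofReal_tsum_of_nonneg hnonneg hscaled.summable]
  refine ENNReal.tsum_le_tsum fun n => ENNReal.ofReal_le_ofReal ?_
  have hbn : ((n : ℝ) + 1) / c ≤ 1 / b (n + 1) := by
    rw [div_le_div_iff₀ hc (hb _), one_mul]
    exact_mod_cast (hnb (n + 1)).le
  calc 1 / c * ∑ k ∈ Finset.range (n + 1), s k * x ^ k * (s (n - k) * x ^ (n - k))
      ≤ 1 / c * ((n + 1) * (x ^ n * s n ^ 2)) := by
        gcongr
        exact hmono.sum_range_mul_pow_le hs0 hx0 n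
    _ = (n + 1) / c * (x ^ n * s n ^ 2) := by ring
    _ ≤ 1 / b (n + 1) * (x ^ n * s n ^ 2) := by gcongr
    _ = x ^ n * s n ^ 2 / b (n + 1) := by ring
end

section
/- Let (bₙ)_{n≥0} be a sequence of positive real numbers such that Σ bₙ xⁿ converges for every x ∈ [0,1), sup_n bₙ/b_{n+1} < ∞ (so that M_z is bounded on H(b)), and suppose there is a constant c > 0 with n·bₙ < c for all n ≥ 0. Then for every θ ∈ [0,2π), every a ∈ 𝔻, and every constant C ≥ 0 such that for all f ∈ H(b) the product φ_{θ,a}·f belongs to H(b) with ‖φ_{θ,a} f‖_{H(b)} ≤ C ‖f‖_{H(b)}, one has C ≥ √(K(a,a)/c) − |a|, where K(a,a) = Σ_{n≥0} bₙ |a|^{2n}. -/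
open Metric

/-- The Möbius transformation `φ_{θ,a}(z) = e^{iθ} (z − a)/(1 − ā z)`. -/
noncomputable def mobius (θ : ℝ) (a z : ℂ) : ℂ :=
  Complex.exp (θ * Complex.I) * (z - a) / (1 - (starRingEnd ℂ) a * z)

/-- A complex power series vanishing on the unit disc has vanishing coefficients. -/
theorem coeff_eq_zero_of_hasSum_zero {d : ℕ → ℂ}
    (h : ∀ z ∈ ball (0 : ℂ) 1, HasSum (fun n => d n * z ^ n) 0) (n : ℕ) : d n = 0 := by
  have hp : HasFPowerSeriesAt (fun _ : ℂ => (0 : ℂ)) (FormalMultilinearSeries.ofScalars ℂ d) 0 := by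
    rw [hasFPowerSeriesAt_iff]
    filter_upwards [ball_mem_nhds (0 : ℂ) one_pos] with z hz
    simpa [FormalMultilinearSeries.coeff_ofScalars, mul_comm] using h z hz
  have h0 : FormalMultilinearSeries.ofScalars ℂ d = 0 := HasFPowerSeriesAt.eq_zero hp
  rw [← FormalMultilinearSeries.coeff_ofScalars (𝕜 := ℂ) (p := d) (n := n), h0]
  rfl

/-- The coefficient recursion obtained from `(1 - ā z) B(z) = e^{iθ} (z - a) A(z)`. -/
theorem mobius_mul_coeff {θ : ℝ} {a : ℂ} (ha : a ∈ ball (0 : ℂ) 1) {f : ℂ → ℂ} {α β : ℕ → ℂ}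
    (hα : ∀ z ∈ ball (0 : ℂ) 1, HasSum (fun n => α n * z ^ n) (f z))
    (hβ : ∀ z ∈ ball (0 : ℂ) 1, HasSum (fun n => β n * z ^ n) (mobius θ a z * f z)) :
    β 0 = -(Complex.exp (θ * Complex.I) * a * α 0) ∧
    ∀ n, β (n + 1) = (starRingEnd ℂ) a * β n +
      Complex.exp (θ * Complex.I) * (α n - a * α (n + 1)) := by
  set ω := Complex.exp (θ * Complex.I) with hω
  let d : ℕ → ℂ := fun n => (β n + ω * a * α n) -
    Nat.casesOn n 0 (fun m => (starRingEnd ℂ) a * β m + ω * α m)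
  have hd : ∀ z ∈ ball (0 : ℂ) 1, HasSum (fun n => d n * z ^ n) 0 := by
    intro z hz
    have hne : 1 - (starRingEnd ℂ) a * z ≠ 0 := by
      intro h0
      have h1 : ‖(starRingEnd ℂ) a * z‖ = 1 := by
        rw [← sub_eq_zero.mp h0, norm_one]
      rw [norm_mul, RCLike.norm_conj] at h1
      rw [mem_ball_zero_iff] at ha hz
      nlinarith [norm_nonneg a, norm_nonneg z]
    have hs : HasSum (fun n => (Nat.casesOn n 0
        (fun m => (starRingEnd ℂ) a * β m + ω * α m) : ℂ) * z ^ n)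
        (z * ((starRingEnd ℂ) a * (mobius θ a z * f z) + ω * f z)) := by
      rw [← hasSum_nat_add_iff' 1]
      have h2 := ((((hβ z hz).mul_left ((starRingEnd ℂ) a)).add
        ((hα z hz).mul_left ω)).mul_left z)
      rw [Finset.sum_range_one]
      change HasSum (fun n => ((starRingEnd ℂ) a * β n + ω * α n) * z ^ (n + 1))
        (z * ((starRingEnd ℂ) a * (mobius θ a z * f z) + ω * f z) - 0 * z ^ 0)
      rw [zero_mul, sub_zero]
      refine h2.congr_fun ?_
      intro n
      ring
    have h3 := ((hβ z hz).add ((hα z hz).mul_left (ω * a))).sub hs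
    have h4 : mobius θ a z * f z + ω * a * f z -
        z * ((starRingEnd ℂ) a * (mobius θ a z * f z) + ω * f z) = 0 := by
      have : mobius θ a z * (1 - (starRingEnd ℂ) a * z) = ω * (z - a) := by
        rw [mobius, div_mul_cancel₀ _ hne]
      linear_combination f z * this
    rw [h4] at h3
    refine h3.congr_fun ?_
    intro n
    simp only [d]
    ring
  have hd0 := coeff_eq_zero_of_hasSum_zero hd
  refine ⟨?_, fun n => ?_⟩
  · have : β 0 + ω * a * α 0 - 0 = 0 := hd0 0
    linear_combination this
  · have : β (n + 1) + ω * a * α (n + 1) - ((starRingEnd ℂ) a * β n + ω * α n) = 0 :=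
      hd0 (n + 1)
    linear_combination this

/-- The coefficients of `(φ_{θ,a} + e^{iθ} a) f` when `f = Σ bₙ āⁿ zⁿ`. -/
theorem mobius_mul_kernel_coeff {ω a : ℂ} {b : ℕ → ℝ} {β : ℕ → ℂ}
    (h0 : β 0 = -(ω * a * (b 0 * (starRingEnd ℂ) a ^ 0)))
    (h1 : ∀ n, β (n + 1) = (starRingEnd ℂ) a * β n +
      ω * (b n * (starRingEnd ℂ) a ^ n - a * (b (n + 1) * (starRingEnd ℂ) a ^ (n + 1)))) (n : ℕ) :
    β (n + 1) + ω * a * (b (n + 1) * (starRingEnd ℂ) a ^ (n + 1)) =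
      ω * (1 - a * (starRingEnd ℂ) a) * (starRingEnd ℂ) a ^ n *
        (∑ k ∈ Finset.range (n + 1), b k : ℝ) := by
  induction n with
  | zero =>
    rw [h1, h0]
    simp
    ring
  | succ n ih =>
    rw [h1, Finset.sum_range_succ]
    push_cast at ih ⊢
    linear_combination (starRingEnd ℂ) a * ih

/-- With `Sₙ = b₀ + ⋯ + bₙ`, one has `(Σ bₙ rⁿ)² ≤ (1 - r)² Σ (n + 1) rⁿ Sₙ²`. -/
theorem sq_tsum_le_tsum_partial_sums {b : ℕ → ℝ} (hb : ∀ n, 0 ≤ b n) {r : ℝ} (hr0 : 0 ≤ r)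
    (hr1 : r < 1) (hK : Summable (fun n => b n * r ^ n))
    (hS : Summable (fun n : ℕ => ((n : ℝ) + 1) * r ^ n * (∑ k ∈ Finset.range (n + 1), b k) ^ 2)) :
    (∑' n, b n * r ^ n) ^ 2 ≤
      (1 - r) ^ 2 * ∑' n : ℕ, ((n : ℝ) + 1) * r ^ n * (∑ k ∈ Finset.range (n + 1), b k) ^ 2 := by
  set S : ℕ → ℝ := fun n => ∑ k ∈ Finset.range (n + 1), b k with hSdef
  have hg := summable_geometric_of_lt_one hr0 hr1
  have hmono : Monotone S := fun m n hmn =>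
    Finset.sum_le_sum_of_subset_of_nonneg (Finset.range_mono (by omega)) (fun i _ _ => hb i)
  have hS0 : ∀ n, 0 ≤ S n := fun n => Finset.sum_nonneg fun i _ => hb i
  have hterm : ∀ n, ∑ kl ∈ Finset.HasAntidiagonal.antidiagonal n, (b kl.1 * r ^ kl.1) * r ^ kl.2 = S n * r ^ n := by
    intro n
    rw [Finset.Nat.sum_antidiagonal_eq_sum_range_succ_mk, hSdef, Finset.sum_mul]
    refine Finset.sum_congr rfl fun k hk => ?_
    rw [mul_assoc, ← pow_add]
    congr 2
    have := Finset.mem_range.mp hk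
    omega
  have hKn : Summable (fun n => ‖b n * r ^ n‖) := hK.norm
  have hgn : Summable (fun n => ‖r ^ n‖) := hg.norm
  have h1 : (∑' n, b n * r ^ n) * (1 - r)⁻¹ = ∑' n, S n * r ^ n := by
    rw [← tsum_geometric_of_lt_one hr0 hr1,
      tsum_mul_tsum_eq_tsum_sum_antidiagonal_of_summable_norm hKn hgn]
    exact tsum_congr hterm
  have hSr : Summable (fun n => ‖S n * r ^ n‖) := by
    have := summable_norm_sum_mul_antidiagonal_of_summable_norm hKn hgn
    simpa only [hterm] using this
  have h2 : (∑' n, S n * r ^ n) ^ 2 ≤ ∑' n : ℕ, ((n : ℝ) + 1) * r ^ n * S n ^ 2 := by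
    rw [sq, tsum_mul_tsum_eq_tsum_sum_antidiagonal_of_summable_norm hSr hSr]
    refine Summable.tsum_le_tsum (fun n => ?_)
      (summable_norm_sum_mul_antidiagonal_of_summable_norm hSr hSr).of_norm hS
    calc ∑ kl ∈ Finset.HasAntidiagonal.antidiagonal n, S kl.1 * r ^ kl.1 * (S kl.2 * r ^ kl.2)
        ≤ ∑ kl ∈ Finset.HasAntidiagonal.antidiagonal n, r ^ n * S n ^ 2 := by
          refine Finset.sum_le_sum fun kl hkl => ?_
          have hsum := Finset.HasAntidiagonal.mem_antidiagonal.mp hkl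
          have e : S kl.1 * r ^ kl.1 * (S kl.2 * r ^ kl.2) = r ^ n * (S kl.1 * S kl.2) := by
            rw [← hsum, pow_add]
            ring
          rw [e, sq]
          have l1 : S kl.1 ≤ S n := hmono (by omega)
          have l2 : S kl.2 ≤ S n := hmono (by omega)
          exact mul_le_mul_of_nonneg_left
            (mul_le_mul l1 l2 (hS0 _) (hS0 _)) (pow_nonneg hr0 n)
      _ = ((n : ℝ) + 1) * r ^ n * S n ^ 2 := by
          rw [Finset.sum_const, Finset.Nat.card_antidiagonal, nsmul_eq_mul]
          push_cast
          ring
  have hr : 1 - r ≠ 0 := by linarith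
  have h3 : ∑' n, b n * r ^ n = (1 - r) * ∑' n, S n * r ^ n := by
    rw [← h1]
    field_simp
  rw [h3, mul_pow]
  exact mul_le_mul_of_nonneg_left h2 (sq_nonneg _)

/-- A weighted Minkowski inequality in `ℓ²`, with squared bounds. -/
theorem tsum_norm_add_sq_div_le {b : ℕ → ℝ} (hb : ∀ n, 0 < b n) {β α : ℕ → ℂ} {u : ℂ} {D K : ℝ}
    (hD : 0 < D) (hβ : Summable (fun n => ‖β n‖ ^ 2 / b n))
    (hα : Summable (fun n => ‖α n‖ ^ 2 / b n))
    (hβK : ∑' n, ‖β n‖ ^ 2 / b n ≤ D ^ 2 * K) (hαK : ∑' n, ‖α n‖ ^ 2 / b n = K) :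
    Summable (fun n => ‖β n + u * α n‖ ^ 2 / b n) ∧
      ∑' n, ‖β n + u * α n‖ ^ 2 / b n ≤ (D + ‖u‖) ^ 2 * K := by
  have hle : ∀ n, ‖β n + u * α n‖ ^ 2 / b n ≤
      (1 + ‖u‖ / D) * (‖β n‖ ^ 2 / b n) + (‖u‖ ^ 2 + ‖u‖ * D) * (‖α n‖ ^ 2 / b n) := by
    intro n
    have h1 : ‖β n + u * α n‖ ≤ ‖β n‖ + ‖u‖ * ‖α n‖ := by
      simpa only [norm_mul] using norm_add_le (β n) (u * α n)
    have h2 : ‖β n + u * α n‖ ^ 2 ≤ (‖β n‖ + ‖u‖ * ‖α n‖) ^ 2 :=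
      pow_le_pow_left₀ (norm_nonneg _) h1 2
    have h3 : (1 + ‖u‖ / D) * ‖β n‖ ^ 2 + (‖u‖ ^ 2 + ‖u‖ * D) * ‖α n‖ ^ 2 -
        (‖β n‖ + ‖u‖ * ‖α n‖) ^ 2 = ‖u‖ / D * (‖β n‖ - D * ‖α n‖) ^ 2 := by
      field_simp
      ring
    have h4 : 0 ≤ ‖u‖ / D * (‖β n‖ - D * ‖α n‖) ^ 2 := by positivity
    rw [mul_div_assoc', mul_div_assoc', ← add_div]
    exact div_le_div_of_nonneg_right (by linarith) (hb n).le
  have hs := (hβ.mul_left (1 + ‖u‖ / D)).add (hα.mul_left (‖u‖ ^ 2 + ‖u‖ * D))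
  have hsum : Summable (fun n => ‖β n + u * α n‖ ^ 2 / b n) :=
    Summable.of_nonneg_of_le (fun n => div_nonneg (sq_nonneg _) (hb n).le) hle hs
  refine ⟨hsum, (hsum.tsum_le_tsum hle hs).trans ?_⟩
  rw [(hβ.mul_left _).tsum_add (hα.mul_left _), tsum_mul_left, tsum_mul_left, hαK]
  calc (1 + ‖u‖ / D) * ∑' n, ‖β n‖ ^ 2 / b n + (‖u‖ ^ 2 + ‖u‖ * D) * K
      ≤ (1 + ‖u‖ / D) * (D ^ 2 * K) + (‖u‖ ^ 2 + ‖u‖ * D) * K := by gcongr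
    _ = (D + ‖u‖) ^ 2 * K := by
      field_simp
      ring

/-- Let `(bₙ)` be positive with `Σ bₙ xⁿ < ∞` on `[0,1)`,
`sup bₙ/b_{n+1} < ∞`, and `n bₙ < c`. If `C ≥ 0` is a bound for the multiplication operator
`M_{φ_{θ,a}}` on the weighted Hardy space `H(b)`, then `C ≥ √(K(a,a)/c) − |a|`, where
`K(a,a) = Σₙ bₙ |a|^{2n}`. -/
theorem stmt_8 (b : ℕ → ℝ) (hb : ∀ n, 0 < b n)
    (hconv : ∀ x ∈ Set.Ico (0 : ℝ) 1, Summable (fun n => b n * x ^ n))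
    (hshift : ∃ M : ℝ, ∀ n, b n / b (n + 1) ≤ M)
    (c : ℝ) (hc : 0 < c) (hnb : ∀ n : ℕ, (n : ℝ) * b n < c)
    (θ : ℝ) (hθ : θ ∈ Set.Ico 0 (2 * Real.pi)) (a : ℂ) (ha : a ∈ ball (0 : ℂ) 1)
    (C : ℝ) (hC : 0 ≤ C)
    (hbound : ∀ (f : ℂ → ℂ) (α : ℕ → ℂ),
      (∀ z ∈ ball (0 : ℂ) 1, HasSum (fun n => α n * z ^ n) (f z)) →
      Summable (fun n => ‖α n‖ ^ 2 / b n) →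
      ∃ β : ℕ → ℂ,
        (∀ z ∈ ball (0 : ℂ) 1, HasSum (fun n => β n * z ^ n) (mobius θ a z * f z)) ∧
        Summable (fun n => ‖β n‖ ^ 2 / b n) ∧
        ∑' n, ‖β n‖ ^ 2 / b n ≤ C ^ 2 * ∑' n, ‖α n‖ ^ 2 / b n) :
    Real.sqrt ((∑' n, b n * ‖a‖ ^ (2 * n)) / c) - ‖a‖ ≤ C := by
  set r : ℝ := ‖a‖ ^ 2 with hr
  have ha1 : ‖a‖ < 1 := mem_ball_zero_iff.mp ha
  have hr0 : 0 ≤ r := sq_nonneg _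
  have hr1 : r < 1 := by nlinarith [norm_nonneg a]
  have hKsum : Summable (fun n => b n * r ^ n) := hconv r ⟨hr0, hr1⟩
  have hKeq : ∑' n, b n * ‖a‖ ^ (2 * n) = ∑' n, b n * r ^ n := by simp only [hr, pow_mul]
  rw [hKeq]
  set K := ∑' n, b n * r ^ n with hK
  have hKpos : 0 < K :=
    hKsum.tsum_pos (fun n => mul_nonneg (hb n).le (pow_nonneg hr0 n)) 0 (by simpa using hb 0)
  let α : ℕ → ℂ := fun n => b n * (starRingEnd ℂ) a ^ n
  have hαnorm : ∀ n, ‖α n‖ ^ 2 / b n = b n * r ^ n := by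
    intro n
    have := (hb n).ne'
    simp only [α, norm_mul, norm_pow, RCLike.norm_conj, Complex.norm_real, Real.norm_eq_abs,
      abs_of_pos (hb n), hr]
    field_simp
    ring
  have hαsum : Summable (fun n => ‖α n‖ ^ 2 / b n) := by simpa only [hαnorm] using hKsum
  have hαK : ∑' n, ‖α n‖ ^ 2 / b n = K := by simp only [hαnorm, hK]
  have hα : ∀ z ∈ ball (0 : ℂ) 1,
      HasSum (fun n => α n * z ^ n) ((fun z => ∑' n, α n * z ^ n) z) := by
    intro z hz
    rw [mem_ball_zero_iff] at hz
    refine Summable.hasSum (Summable.of_norm ?_)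
    have h1 : ‖a‖ * ‖z‖ < 1 := by nlinarith [norm_nonneg a, norm_nonneg z]
    refine (hconv (‖a‖ * ‖z‖) ⟨by positivity, h1⟩).congr fun n => ?_
    simp only [α, norm_mul, norm_pow, RCLike.norm_conj, Complex.norm_real, Real.norm_eq_abs,
      abs_of_pos (hb n), mul_pow, mul_assoc]
  obtain ⟨β, hβ, hβsum, hβle⟩ := hbound _ α hα hαsum
  rw [hαK] at hβle
  obtain ⟨h0, h1⟩ := mobius_mul_coeff ha hα hβ
  have hγ := mobius_mul_kernel_coeff h0 h1
  set ω := Complex.exp (θ * Complex.I) with hω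
  have hωn : ‖ω‖ = 1 := Complex.norm_exp_ofReal_mul_I θ
  have hγn : ∀ n, ‖β (n + 1) + ω * a * α (n + 1)‖ ^ 2 =
      (1 - r) ^ 2 * (r ^ n * (∑ k ∈ Finset.range (n + 1), b k) ^ 2) := by
    intro n
    have e : β (n + 1) + ω * a * α (n + 1) = _ := hγ n
    have e2 : (1 : ℂ) - a * (starRingEnd ℂ) a = ((1 - r : ℝ) : ℂ) := by
      rw [Complex.mul_conj, Complex.normSq_eq_norm_sq, ← hr]
      push_cast
      rfl
    rw [e, e2]
    simp only [norm_mul, norm_pow, RCLike.norm_conj, Complex.norm_real, Real.norm_eq_abs, hωn,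
      mul_pow, sq_abs, hr]
    ring
  have hrec : ∀ n : ℕ, (1 - r) ^ 2 *
      (((n : ℝ) + 1) * r ^ n * (∑ k ∈ Finset.range (n + 1), b k) ^ 2) ≤
      c * (‖β (n + 1) + ω * a * α (n + 1)‖ ^ 2 / b (n + 1)) := by
    intro n
    have h2 := (hnb (n + 1)).le
    push_cast at h2
    rw [mul_div_assoc', le_div_iff₀ (hb _), hγn]
    have h3 : 0 ≤ (1 - r) ^ 2 * (r ^ n * (∑ k ∈ Finset.range (n + 1), b k) ^ 2) := by positivity
    nlinarith [mul_le_mul_of_nonneg_right h2 h3]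
  refine le_of_forall_gt_imp_ge_of_dense fun D hD => ?_
  have hD0 : 0 < D := hC.trans_lt hD
  have hβD : ∑' n, ‖β n‖ ^ 2 / b n ≤ D ^ 2 * K := hβle.trans (by gcongr)
  obtain ⟨hs, hle⟩ := tsum_norm_add_sq_div_le hb (u := ω * a) hD0 hβsum hαsum hβD hαK
  rw [norm_mul, hωn, one_mul] at hle
  have hs1 := ((summable_nat_add_iff 1).mpr hs).mul_left c
  have hs2 := Summable.of_nonneg_of_le (fun n => by positivity) hrec hs1
  have hs3 := (summable_mul_left_iff (pow_ne_zero 2 (by linarith : 1 - r ≠ 0))).mp hs2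
  have hshift_le : ∑' n, ‖β (n + 1) + ω * a * α (n + 1)‖ ^ 2 / b (n + 1) ≤
      (D + ‖a‖) ^ 2 * K := by
    have h5 := hs.tsum_eq_zero_add
    have h6 : 0 ≤ ‖β 0 + ω * a * α 0‖ ^ 2 / b 0 := div_nonneg (sq_nonneg _) (hb 0).le
    linarith
  have hmain : K ^ 2 ≤ c * ((D + ‖a‖) ^ 2 * K) := by
    calc K ^ 2 ≤ _ := sq_tsum_le_tsum_partial_sums (fun n => (hb n).le) hr0 hr1 hKsum hs3
      _ ≤ c * ∑' n, ‖β (n + 1) + ω * a * α (n + 1)‖ ^ 2 / b (n + 1) := by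
        rw [← tsum_mul_left, ← tsum_mul_left]
        exact hs2.tsum_le_tsum hrec hs1
      _ ≤ _ := by gcongr
  have hfin : K ≤ (D + ‖a‖) ^ 2 * c := by
    refine le_of_mul_le_mul_right ?_ hKpos
    linarith
  have hsqrt : Real.sqrt (K / c) ≤ D + ‖a‖ := by
    rw [Real.sqrt_le_left (by positivity), div_le_iff₀ hc]
    exact hfin
  linarith
end

section
/- Let (bₙ)_{n≥0} be a sequence of positive real numbers such that Σ bₙ xⁿ converges for every x ∈ [0,1) and sup_n bₙ/b_{n+1} < ∞. Suppose the multiplication operator M_z on H(b) is Möbius bounded, i.e., there exists c > 0 such that for every θ ∈ [0,2π), a ∈ 𝔻 and f ∈ H(b), the product φ_{θ,a}·f belongs to H(b) with ‖φ_{θ,a} f‖_{H(b)} ≤ c ‖f‖_{H(b)}. Then (i) Σ_{n≥0} bₙ = ∞, and (ii) the sequence (n·bₙ)_{n≥0} is unbounded. -/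
open Metric

/-- The multiplication operator `M_z` on the weighted Hardy space `H(b)` (with
`‖Σ αₙ zⁿ‖² = Σ |αₙ|²/bₙ`) is Möbius bounded: there is a single constant `c > 0` bounding the
norm of the multiplication operator `M_{φ_{θ,a}}` on `H(b)` for every `φ_{θ,a} ∈ Möb`. -/
def MobiusBounded (b : ℕ → ℝ) : Prop :=
  ∃ c : ℝ, 0 < c ∧ ∀ θ ∈ Set.Ico (0 : ℝ) (2 * Real.pi), ∀ a ∈ ball (0 : ℂ) 1,
    ∀ (f : ℂ → ℂ) (α : ℕ → ℂ),
      (∀ z ∈ ball (0 : ℂ) 1, HasSum (fun n => α n * z ^ n) (f z)) →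
      Summable (fun n => ‖α n‖ ^ 2 / b n) →
      ∃ β : ℕ → ℂ,
        (∀ z ∈ ball (0 : ℂ) 1, HasSum (fun n => β n * z ^ n) (mobius θ a z * f z)) ∧
        Summable (fun n => ‖β n‖ ^ 2 / b n) ∧
        ∑' n, ‖β n‖ ^ 2 / b n ≤ c ^ 2 * ∑' n, ‖α n‖ ^ 2 / b n

/-- The Taylor coefficients at `0` of the Möbius transformation `φ_{0,r}`, `r` real. -/
noncomputable def mobiusCoeff (r : ℝ) (n : ℕ) : ℝ :=
  if n = 0 then -r else (1 - r ^ 2) * r ^ (n - 1)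

lemma hasSum_mobiusCoeff {r : ℝ} (hr0 : 0 ≤ r) (hr1 : r < 1) {z : ℂ} (hz : z ∈ ball (0 : ℂ) 1) :
    HasSum (fun n => (mobiusCoeff r n : ℂ) * z ^ n) (mobius 0 r z) := by
  have hz1 : ‖z‖ < 1 := by simpa using hz
  have hlt : ‖(r : ℂ) * z‖ < 1 := by
    rw [norm_mul, Complex.norm_real, Real.norm_of_nonneg hr0]
    nlinarith [norm_nonneg z]
  have hne : (1 : ℂ) - r * z ≠ 0 := by
    intro h
    rw [← sub_eq_zero.mp h] at hlt
    simp at hlt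
  rw [← hasSum_nat_add_iff' 1]
  convert! (hasSum_geometric_of_norm_lt_one hlt).mul_left ((1 - (r : ℂ) ^ 2) * z) using 1
  · funext n
    simp only [mobiusCoeff, Nat.add_eq_zero_iff, one_ne_zero, and_false, if_false,
      Nat.add_sub_cancel]
    push_cast
    ring
  · simp only [mobius, mobiusCoeff, Finset.range_one, Finset.sum_singleton, if_true,
      Complex.ofReal_zero, zero_mul, Complex.exp_zero, Complex.conj_ofReal]
    push_cast
    linear_combination (-(r : ℂ)) * mul_inv_cancel₀ hne

lemma hasSum_shift {m : ℕ → ℂ} {z s : ℂ} (h : HasSum (fun n => m n * z ^ n) s) (j : ℕ) :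
    HasSum (fun k => (if j ≤ k then m (k - j) else 0) * z ^ k) (z ^ j * s) := by
  rw [← hasSum_nat_add_iff' j, Finset.sum_eq_zero, sub_zero]
  · convert! h.mul_left (z ^ j) using 1
    funext n
    simp only [Nat.le_add_left, if_true, Nat.add_sub_cancel]
    ring
  · intro i hi
    simp [Finset.mem_range.mp hi]

/-- The coefficients of a power series converging on the unit disc are determined by its sum. -/
lemma coeff_unique_of_hasSum {β γ : ℕ → ℂ} {g : ℂ → ℂ}
    (hβ : ∀ z ∈ ball (0 : ℂ) 1, HasSum (fun n => β n * z ^ n) (g z))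
    (hγ : ∀ z ∈ ball (0 : ℂ) 1, HasSum (fun n => γ n * z ^ n) (g z)) : β = γ := by
  have key : ∀ δ : ℕ → ℂ, (∀ z ∈ ball (0 : ℂ) 1, HasSum (fun n => δ n * z ^ n) (g z)) →
      HasFPowerSeriesAt g (FormalMultilinearSeries.ofScalars ℂ δ) 0 := by
    intro δ hδ
    rw [hasFPowerSeriesAt_iff]
    filter_upwards [ball_mem_nhds (0 : ℂ) one_pos] with z hz
    simpa [FormalMultilinearSeries.coeff_ofScalars, mul_comm] using hδ z hz
  have h := (key β hβ).eq_formalMultilinearSeries (key γ hγ)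
  funext n
  simpa [FormalMultilinearSeries.coeff_ofScalars] using congrArg (fun p => p.coeff n) h

/-- Testing Möbius boundedness on the truncated kernel `∑_{j<N} bⱼ zʲ`. -/
lemma MobiusBounded.exists_bound {b : ℕ → ℝ} (hb : ∀ n, 0 < b n) (hmob : MobiusBounded b) :
    ∃ C : ℝ, 0 < C ∧ ∀ N : ℕ, 0 < N →
      (∑ j ∈ Finset.range N, b j) * ∑ k ∈ Finset.Ico N (2 * N), 1 / b k ≤ C * (N : ℝ) ^ 2 := by
  obtain ⟨c, hc, h⟩ := hmob
  refine ⟨64 * c ^ 2, by positivity, fun N hN => ?_⟩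
  have hN1 : (1 : ℝ) ≤ N := by exact_mod_cast hN
  have hNpos : (0 : ℝ) < N := by linarith
  set S := ∑ j ∈ Finset.range N, b j with hS
  have hSpos : 0 < S := Finset.sum_pos (fun j _ => hb j) ⟨0, Finset.mem_range.mpr hN⟩
  set r : ℝ := 1 - 1 / (2 * N) with hr
  have hinv : 1 / (2 * (N : ℝ)) ≤ 1 / 2 :=
    one_div_le_one_div_of_le (by norm_num) (by linarith)
  have hinv0 : 0 < 1 / (2 * (N : ℝ)) := by positivity
  have hr0 : 0 ≤ r := by linarith
  have hr1 : r < 1 := by linarith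
  have hrN : 1 / 2 ≤ r ^ N := by
    have := one_add_mul_le_pow (a := -(1 / (2 * (N : ℝ)))) (by linarith) N
    have h2 : (1 : ℝ) + N * -(1 / (2 * (N : ℝ))) = 1 / 2 := by field_simp; norm_num
    rw [h2] at this
    simpa [hr, sub_eq_add_neg] using this
  have hr2N : 1 / 4 ≤ r ^ (2 * N) := by
    rw [mul_comm, pow_mul]
    nlinarith
  have hsq : 1 / (2 * (N : ℝ)) ≤ 1 - r ^ 2 := by
    nlinarith
  let α : ℕ → ℂ := fun n => if n < N then (b n : ℂ) else 0
  let γ : ℕ → ℝ := fun k => ∑ j ∈ Finset.range N,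
    b j * (if j ≤ k then mobiusCoeff r (k - j) else 0)
  have hα : HasSum (fun n => ‖α n‖ ^ 2 / b n) S := by
    have hval : S = ∑ n ∈ Finset.range N, ‖α n‖ ^ 2 / b n := by
      refine Finset.sum_congr rfl fun n hn => ?_
      have := (hb n).ne'
      simp only [α, Finset.mem_range.mp hn, if_true, Complex.norm_real, Real.norm_eq_abs, sq_abs]
      field_simp
    rw [hval]
    refine hasSum_sum_of_ne_finset_zero fun n hn => ?_
    simp [α, Finset.mem_range.not.mp hn]
  have hf : ∀ z ∈ ball (0 : ℂ) 1, HasSum (fun n => α n * z ^ n)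
      (∑ j ∈ Finset.range N, (b j : ℂ) * z ^ j) := by
    intro z _
    have hval : ∑ j ∈ Finset.range N, (b j : ℂ) * z ^ j
        = ∑ j ∈ Finset.range N, α j * z ^ j :=
      Finset.sum_congr rfl fun n hn => by simp [α, Finset.mem_range.mp hn]
    rw [hval]
    refine hasSum_sum_of_ne_finset_zero fun n hn => ?_
    simp [α, Finset.mem_range.not.mp hn]
  have hra : (r : ℂ) ∈ ball (0 : ℂ) 1 := by
    simpa [abs_of_nonneg hr0] using hr1
  obtain ⟨β, hβ, hβs, hle⟩ := h 0 ⟨le_rfl, by positivity⟩ r hra _ α hf hα.summable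
  have hγ : ∀ z ∈ ball (0 : ℂ) 1, HasSum (fun n => (γ n : ℂ) * z ^ n)
      (mobius 0 r z * ∑ j ∈ Finset.range N, (b j : ℂ) * z ^ j) := by
    intro z hz
    have := hasSum_sum (s := Finset.range N) fun j _ =>
      (hasSum_shift (hasSum_mobiusCoeff hr0 hr1 hz) j).mul_left (b j : ℂ)
    convert! this using 1
    · funext k
      simp only [γ]
      push_cast
      rw [Finset.sum_mul]
      refine Finset.sum_congr rfl fun j _ => ?_
      split_ifs <;> push_cast <;> ring
    · rw [Finset.mul_sum]
      exact Finset.sum_congr rfl fun j _ => by ring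
  obtain rfl : β = fun n => (γ n : ℂ) :=
    coeff_unique_of_hasSum (by simpa using hβ) hγ
  rw [hα.tsum_eq] at hle
  have hγk : ∀ k ∈ Finset.Ico N (2 * N), S / (8 * N) ≤ γ k := by
    intro k hk
    obtain ⟨hk1, hk2⟩ := Finset.mem_Ico.mp hk
    rw [hS, Finset.sum_div]
    refine Finset.sum_le_sum fun j hj => ?_
    have hj := Finset.mem_range.mp hj
    rw [if_pos (by omega), mobiusCoeff, if_neg (by omega), div_eq_mul_inv]
    refine mul_le_mul_of_nonneg_left ?_ (hb j).le
    have h1 : 1 / 4 ≤ r ^ (k - j - 1) :=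
      hr2N.trans (pow_le_pow_of_le_one hr0 hr1.le (by omega))
    calc (8 * (N : ℝ))⁻¹ = 1 / (2 * (N : ℝ)) * (1 / 4) := by field_simp; norm_num
      _ ≤ _ := mul_le_mul hsq h1 (by norm_num) (hinv0.le.trans hsq)
  have hsum : (S / (8 * N)) ^ 2 * ∑ k ∈ Finset.Ico N (2 * N), 1 / b k ≤ c ^ 2 * S := by
    refine le_trans ?_ hle
    refine le_trans ?_ (hβs.sum_le_tsum (Finset.Ico N (2 * N))
      fun k _ => div_nonneg (sq_nonneg _) (hb k).le)
    rw [Finset.mul_sum]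
    refine Finset.sum_le_sum fun k hk => ?_
    rw [Complex.norm_real, Real.norm_eq_abs, sq_abs, mul_one_div]
    have := hb k
    have := hγk k hk
    gcongr
  set T := ∑ k ∈ Finset.Ico N (2 * N), 1 / b k
  have h3 : (S / (8 * N)) ^ 2 * T = S * (S * T) / (64 * (N : ℝ) ^ 2) := by
    ring
  rw [h3, div_le_iff₀ (by positivity)] at hsum
  refine le_of_mul_le_mul_left ?_ hSpos
  linarith

/-- If `M_z` is Möbius bounded on `H(b)` then `Σ bₙ = ∞`. -/
lemma MobiusBounded.not_summable {b : ℕ → ℝ} (hb : ∀ n, 0 < b n) (hmob : MobiusBounded b) :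
    ¬ Summable b := by
  intro hs
  obtain ⟨C, hC, h⟩ := hmob.exists_bound hb
  have hgrow : ∀ N : ℕ, 0 < N → ∑ j ∈ Finset.range N, b j ≤
      C * (∑ j ∈ Finset.range (2 * N), b j - ∑ j ∈ Finset.range N, b j) := by
    intro N hN
    rw [← Finset.sum_Ico_eq_sub _ (by omega : N ≤ 2 * N)]
    have hTpos : 0 < ∑ k ∈ Finset.Ico N (2 * N), 1 / b k :=
      Finset.sum_pos (fun k _ => one_div_pos.mpr (hb k)) ⟨N, by simp; omega⟩
    have hcs := Finset.sum_sq_le_sum_mul_sum_of_sq_le_mul (Finset.Ico N (2 * N))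
      (r := fun _ => (1 : ℝ)) (f := b) (g := fun k => 1 / b k) (fun k _ => (hb k).le)
      (fun k _ => (one_div_pos.mpr (hb k)).le)
      (fun k _ => by have := (hb k).ne'; field_simp; exact le_rfl)
    have hcard : ∑ _k ∈ Finset.Ico N (2 * N), (1 : ℝ) = N := by
      simp [two_mul]
    rw [hcard] at hcs
    refine le_of_mul_le_mul_right ?_ hTpos
    nlinarith [h N hN]
  have hlim := hs.hasSum.tendsto_sum_nat
  have hlim2 := hlim.comp (Filter.tendsto_id.const_mul_atTop' (r := 2) two_pos)
  have hle := le_of_tendsto_of_tendsto hlim ((hlim2.sub hlim).const_mul C)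
    (by filter_upwards [Filter.eventually_gt_atTop 0] with N hN using hgrow N hN)
  have hpos : 0 < ∑' n, b n := hs.tsum_pos (fun n => (hb n).le) 0 (hb 0)
  simp at hle
  linarith

/-- If `(bₙ)` is positive, `Σ bₙ xⁿ < ∞` on `[0,1)`, `sup bₙ/b_{n+1} < ∞`, and
`M_z` on `H(b)` is Möbius bounded, then (i) `Σ bₙ = ∞` and (ii) `(n bₙ)` is unbounded. -/
theorem stmt_9 (b : ℕ → ℝ) (hb : ∀ n, 0 < b n)
    (hconv : ∀ x ∈ Set.Ico (0 : ℝ) 1, Summable (fun n => b n * x ^ n))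
    (hshift : ∃ M : ℝ, ∀ n, b n / b (n + 1) ≤ M)
    (hmob : MobiusBounded b) :
    ¬ Summable b ∧ ∀ M : ℝ, ∃ n : ℕ, M < (n : ℝ) * b n := by
  refine ⟨hmob.not_summable hb, fun M => ?_⟩
  by_contra! hM
  refine hmob.not_summable hb ?_
  obtain ⟨C, hC, h⟩ := hmob.exists_bound hb
  have hMpos : 0 < M := (hb 1).trans_le (by simpa using hM 1)
  have hbound : ∀ N : ℕ, 0 < N → ∑ j ∈ Finset.range N, b j ≤ C * M := by
    intro N hN
    have hNpos : (0 : ℝ) < N := by exact_mod_cast hN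
    have hT : (N : ℝ) ^ 2 / M ≤ ∑ k ∈ Finset.Ico N (2 * N), 1 / b k := by
      have := Finset.card_nsmul_le_sum (Finset.Ico N (2 * N)) (fun k => 1 / b k) (N / M)
        fun k hk => by
          rw [div_le_div_iff₀ hMpos (hb k), one_mul]
          refine le_trans ?_ (hM k)
          have : (N : ℝ) ≤ k := by exact_mod_cast (Finset.mem_Ico.mp hk).1
          exact mul_le_mul_of_nonneg_right this (hb k).le
      refine le_trans (le_of_eq ?_) this
      rw [Nat.card_Ico, nsmul_eq_mul, show 2 * N - N = N by omega]
      ring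
    have hS : 0 ≤ ∑ j ∈ Finset.range N, b j := Finset.sum_nonneg fun j _ => (hb j).le
    have h2 := (mul_le_mul_of_nonneg_left hT hS).trans (h N hN)
    rw [← mul_div_assoc, div_le_iff₀ hMpos] at h2
    refine le_of_mul_le_mul_right ?_ (by positivity : 0 < (N : ℝ) ^ 2)
    linarith
  refine summable_of_sum_range_le (c := C * M) (fun n => (hb n).le) fun N => ?_
  rcases Nat.eq_zero_or_pos N with rfl | hN
  · simpa using (mul_pos hC hMpos).le
  · exact hbound N hN
end

section
/- Let (bₙ)_{n≥0} be a sequence of positive real numbers with Σ_{n≥0} bₙ < ∞. Then Σ_{n≥0} (n+1) / (1/b₀ + 1/b₁ + ⋯ + 1/bₙ) ≤ 2 Σ_{n≥0} bₙ. -/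
/-- Sedrakyan's lemma (Titu's form of Cauchy–Schwarz) for two terms. -/
theorem add_sq_div_add_le_sq_div_add_sq_div (p q : ℝ) {s x : ℝ} (hs : 0 < s) (hx : 0 < x) :
    (p + q) ^ 2 / (s + x) ≤ p ^ 2 / s + q ^ 2 / x := by
  have h : p ^ 2 / s + q ^ 2 / x - (p + q) ^ 2 / (s + x)
      = (p * x - q * s) ^ 2 / (s * x * (s + x)) := by
    field_simp
    ring
  have : 0 ≤ (p * x - q * s) ^ 2 / (s * x * (s + x)) := by positivity
  linarith

/-- Finite form of the inequality, with the extra term that makes induction work. -/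
theorem sum_div_sum_inv_add_le (b : ℕ → ℝ) (hb : ∀ n, 0 < b n) (n : ℕ) :
    ∑ k ∈ Finset.range (n + 1), ((k : ℝ) + 1) / ∑ j ∈ Finset.range (k + 1), (b j)⁻¹
      + ((n : ℝ) + 1) ^ 2 / 2 / ∑ j ∈ Finset.range (n + 1), (b j)⁻¹
      ≤ 2 * ∑ k ∈ Finset.range (n + 1), b k := by
  induction n with
  | zero =>
    have := hb 0
    simp
    linarith
  | succ n ih =>
    rw [Finset.sum_range_succ _ (n + 1), Finset.sum_range_succ b (n + 1),
      Finset.sum_range_succ (fun j => (b j)⁻¹) (n + 1)]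
    have hs : 0 < ∑ j ∈ Finset.range (n + 1), (b j)⁻¹ :=
      Finset.sum_pos (fun j _ => inv_pos.2 (hb j)) ⟨0, by simp⟩
    set s := ∑ j ∈ Finset.range (n + 1), (b j)⁻¹
    have hx : 0 < (b (n + 1))⁻¹ := inv_pos.2 (hb _)
    have key := add_sq_div_add_le_sq_div_add_sq_div ((n : ℝ) + 1) 2 hs hx
    have hq : (2 : ℝ) ^ 2 / (b (n + 1))⁻¹ = 4 * b (n + 1) := by
      rw [div_inv_eq_mul]
      norm_num
    have hp : ((n : ℝ) + 1) ^ 2 / 2 / s = ((n : ℝ) + 1) ^ 2 / s / 2 := by ring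
    have hstep : ((n + 1 : ℕ) + 1 : ℝ) / (s + (b (n + 1))⁻¹)
        + ((n + 1 : ℕ) + 1 : ℝ) ^ 2 / 2 / (s + (b (n + 1))⁻¹)
        ≤ ((n : ℝ) + 1 + 2) ^ 2 / (s + (b (n + 1))⁻¹) / 2 := by
      rw [← add_div, div_right_comm]
      gcongr
      push_cast
      nlinarith
    linarith

/-- (A Hardy-type inequality.) If `(bₙ)` are positive reals with
`Σ bₙ < ∞`, then `Σₙ (n+1)/(1/b₀ + 1/b₁ + ⋯ + 1/bₙ) ≤ 2 Σₙ bₙ`. -/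
theorem stmt_14 (b : ℕ → ℝ) (hb : ∀ n, 0 < b n) (hsum : Summable b) :
    Summable (fun n : ℕ => ((n : ℝ) + 1) / ∑ j ∈ Finset.range (n + 1), (b j)⁻¹) ∧
    ∑' n : ℕ, ((n : ℝ) + 1) / ∑ j ∈ Finset.range (n + 1), (b j)⁻¹ ≤ 2 * ∑' n, b n := by
  have hS (n : ℕ) : 0 ≤ ∑ j ∈ Finset.range (n + 1), (b j)⁻¹ :=
    Finset.sum_nonneg fun j _ => (inv_pos.2 (hb j)).le
  have hnonneg (n : ℕ) : 0 ≤ ((n : ℝ) + 1) / ∑ j ∈ Finset.range (n + 1), (b j)⁻¹ :=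
    div_nonneg (by positivity) (hS n)
  have hbound (n : ℕ) : ∑ k ∈ Finset.range n,
      ((k : ℝ) + 1) / ∑ j ∈ Finset.range (k + 1), (b j)⁻¹ ≤ 2 * ∑' n, b n := by
    have h := sum_div_sum_inv_add_le b hb n
    have hlast : 0 ≤ ((n : ℝ) + 1) ^ 2 / 2 / ∑ j ∈ Finset.range (n + 1), (b j)⁻¹ :=
      div_nonneg (by positivity) (hS n)
    have hle := hsum.sum_le_tsum (Finset.range (n + 1)) fun k _ => (hb k).le
    rw [Finset.sum_range_succ _ n] at h
    linarith [hnonneg n]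
  exact ⟨summable_of_sum_range_le hnonneg hbound, Real.tsum_le_of_sum_range_le hnonneg hbound⟩
end

section
/- Let ψ be a complex-valued function which is continuous on the closed unit disc 𝔻̄, holomorphic on 𝔻, and not identically zero on 𝔻̄. Suppose that for every η ∈ Möb there exist holomorphic functions g_η and h_η on 𝔻 and constants 0 < m_η ≤ M_η such that m_η ≤ |g_η(z)| ≤ M_η and m_η ≤ |h_η(z)| ≤ M_η for all z ∈ 𝔻, satisfying ψ(z)·g_η(z) = h_η(z)·η′(η⁻¹(z))·ψ(η⁻¹(z)) for all z ∈ 𝔻. Then ψ is non-vanishing on the closed disc 𝔻̄. -/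
open Metric

/-- The inverse in `Möb` of the Möbius transformation `φ_{θ,a}`:
`φ_{θ,a}⁻¹(w) = (e^{−iθ} w + a)/(1 + ā e^{−iθ} w)`. -/
noncomputable def mobiusInv (θ : ℝ) (a w : ℂ) : ℂ :=
  (Complex.exp (-θ * Complex.I) * w + a) /
    (1 + (starRingEnd ℂ) a * (Complex.exp (-θ * Complex.I) * w))

/-- A function continuous on the closed disc and holomorphic inside vanishes on the closed disc
as soon as it vanishes on the unit circle. -/
theorem eqOn_zero_closedBall_of_eqOn_zero_sphere {ψ : ℂ → ℂ}
    (hcont : ContinuousOn ψ (closedBall 0 1)) (hhol : DifferentiableOn ℂ ψ (ball 0 1))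
    (h : ∀ z ∈ sphere (0 : ℂ) 1, ψ z = 0) : ∀ z ∈ closedBall (0 : ℂ) 1, ψ z = 0 := by
  have hcl : closure (ball (0 : ℂ) 1) = closedBall 0 1 := closure_ball 0 one_ne_zero
  have hd : DiffContOnCl ℂ ψ (ball 0 1) := ⟨hhol, by rwa [hcl]⟩
  intro z hz
  have hle : ‖ψ z‖ ≤ 0 :=
    Complex.norm_le_of_forall_mem_frontier_norm_le isBounded_ball hd
      (fun w hw => by
        rw [frontier_ball 0 one_ne_zero] at hw
        simp [h w hw]) (by rwa [hcl])
  exact norm_le_zero_iff.mp hle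

/-- A function continuous on the closed disc that vanishes on the open disc vanishes on the
closed disc. -/
theorem eqOn_zero_closedBall_of_eqOn_zero_ball {ψ : ℂ → ℂ}
    (hcont : ContinuousOn ψ (closedBall 0 1))
    (h : ∀ z ∈ ball (0 : ℂ) 1, ψ z = 0) : ∀ z ∈ closedBall (0 : ℂ) 1, ψ z = 0 := by
  have hcl : closure (ball (0 : ℂ) 1) = closedBall 0 1 := closure_ball 0 one_ne_zero
  have heq : Set.EqOn ψ (fun _ => 0) (closedBall 0 1) :=
    Set.EqOn.of_subset_closure (s := ball 0 1) h hcont continuousOn_const ball_subset_closedBall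
      hcl.ge
  exact heq

theorem mobius_zero_right (θ : ℝ) :
    mobius θ 0 = fun z => Complex.exp (θ * Complex.I) * z := by
  funext z
  simp [mobius]

theorem mobiusInv_zero_right (θ : ℝ) (w : ℂ) :
    mobiusInv θ 0 w = Complex.exp (-θ * Complex.I) * w := by
  simp [mobiusInv]

/-- Rotations act transitively on the unit circle, with angles taken in `[0, 2π)`. -/
theorem exists_angle_rotate_eq {w ζ : ℂ} (hw : ‖w‖ = 1) (hζ : ‖ζ‖ = 1) :
    ∃ θ ∈ Set.Ico (0 : ℝ) (2 * Real.pi), Complex.exp (-θ * Complex.I) * w = ζ := by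
  have hw0 : w ≠ 0 := norm_ne_zero_iff.mp (by simp [hw])
  have hζ0 : ζ ≠ 0 := norm_ne_zero_iff.mp (by simp [hζ])
  refine ⟨toIcoMod Real.two_pi_pos 0 (w / ζ).arg, ?_, ?_⟩
  · simpa using toIcoMod_mem_Ico Real.two_pi_pos 0 (w / ζ).arg
  · have h : Complex.exp ((toIcoMod Real.two_pi_pos 0 (w / ζ).arg : ℝ) * Complex.I) = w / ζ := by
      have harg := Complex.norm_mul_exp_arg_mul_I (w / ζ)
      rw [norm_div, hw, hζ, div_one, Complex.ofReal_one, one_mul] at harg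
      conv_rhs => rw [← harg]
      rw [Complex.exp_eq_exp_iff_exists_int]
      refine ⟨-toIcoDiv Real.two_pi_pos 0 (w / ζ).arg, ?_⟩
      rw [toIcoMod]
      push_cast [zsmul_eq_mul]
      ring
    rw [neg_mul, Complex.exp_neg, h]
    field_simp

/-- Let `ψ` be continuous on the closed unit disc, holomorphic on the open
disc, and not identically zero. Suppose that for every `η = φ_{θ,a} ∈ Möb` there are holomorphic
functions `g_η, h_η` on the disc, bounded above and below in modulus by constants
`0 < m_η ≤ M_η`, with `ψ(z) g_η(z) = h_η(z) η′(η⁻¹(z)) ψ(η⁻¹(z))` for all `z` in the disc.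
Then `ψ` is non-vanishing on the closed unit disc. -/
theorem stmt_17 (ψ : ℂ → ℂ)
    (hcont : ContinuousOn ψ (closedBall 0 1))
    (hhol : DifferentiableOn ℂ ψ (ball 0 1))
    (hne : ∃ z ∈ closedBall (0 : ℂ) 1, ψ z ≠ 0)
    (hfe : ∀ θ ∈ Set.Ico (0 : ℝ) (2 * Real.pi), ∀ a ∈ ball (0 : ℂ) 1,
      ∃ (g h : ℂ → ℂ) (m M : ℝ), 0 < m ∧ m ≤ M ∧
        DifferentiableOn ℂ g (ball 0 1) ∧ DifferentiableOn ℂ h (ball 0 1) ∧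
        (∀ z ∈ ball (0 : ℂ) 1,
          m ≤ ‖g z‖ ∧ ‖g z‖ ≤ M ∧ m ≤ ‖h z‖ ∧ ‖h z‖ ≤ M) ∧
        (∀ z ∈ ball (0 : ℂ) 1,
          ψ z * g z =
            h z * deriv (mobius θ a) (mobiusInv θ a z) * ψ (mobiusInv θ a z))) :
    ∀ z ∈ closedBall (0 : ℂ) 1, ψ z ≠ 0 := by
  intro z₀ hz₀ hψ₀
  obtain ⟨p, hp, hψp⟩ := hne
  have hθ : (0 : ℝ) ∈ Set.Ico (0 : ℝ) (2 * Real.pi) := ⟨le_rfl, Real.two_pi_pos⟩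
  have hpull : ∀ a ∈ ball (0 : ℂ) 1, ∀ z ∈ ball (0 : ℂ) 1, ψ (mobiusInv 0 a z) = 0 → ψ z = 0 := by
    intro a ha z hz hzero
    obtain ⟨g, h, m, M, hm, -, -, -, hb, he⟩ := hfe 0 hθ a ha
    have hg : g z ≠ 0 := norm_pos_iff.mp (hm.trans_le (hb z hz).1)
    have hez := he z hz
    rw [hzero, mul_zero] at hez
    exact (mul_eq_zero.mp hez).resolve_right hg
  rcases (mem_closedBall_zero_iff.mp hz₀).lt_or_eq with hlt | hone
  · have h0 : ψ 0 = 0 :=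
      hpull z₀ (mem_ball_zero_iff.mpr hlt) 0 (mem_ball_self one_pos) (by simpa [mobiusInv])
    refine hψp (eqOn_zero_closedBall_of_eqOn_zero_ball hcont (fun z hz => ?_) p hp)
    exact hpull (-z) (by simpa using hz) z hz (by simpa [mobiusInv])
  · refine hψp (eqOn_zero_closedBall_of_eqOn_zero_sphere hcont hhol (fun w hw => ?_) p hp)
    have hw1 : ‖w‖ = 1 := mem_sphere_zero_iff_norm.mp hw
    obtain ⟨θ, hθ, hrot⟩ := exists_angle_rotate_eq hw1 hone
    obtain ⟨g, h, m, M, hm, -, -, -, hb, he⟩ := hfe θ hθ 0 (mem_ball_self one_pos)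
    have hnorm : ‖Complex.exp (-θ * Complex.I)‖ = 1 := by
      rw [← Complex.ofReal_neg, Complex.norm_exp_ofReal_mul_I]
    have hbound : ∀ z ∈ ball (0 : ℂ) 1,
        ‖ψ z‖ * m ≤ M * ‖ψ (Complex.exp (-θ * Complex.I) * z)‖ := by
      intro z hz
      obtain ⟨hgm, -, -, hhM⟩ := hb z hz
      have hez := congrArg norm (he z hz)
      have hderiv : ∀ x, deriv (mobius θ 0) x = Complex.exp (θ * Complex.I) := fun x => by
        rw [mobius_zero_right, deriv_const_mul_field, deriv_id'', mul_one]
      rw [hderiv, mobiusInv_zero_right, norm_mul, norm_mul, norm_mul,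
        Complex.norm_exp_ofReal_mul_I, mul_one] at hez
      calc ‖ψ z‖ * m ≤ ‖ψ z‖ * ‖g z‖ := by gcongr
        _ = ‖h z‖ * ‖ψ (Complex.exp (-θ * Complex.I) * z)‖ := hez
        _ ≤ M * ‖ψ (Complex.exp (-θ * Complex.I) * z)‖ := by gcongr
    have hmaps : Set.MapsTo (fun z => Complex.exp (-θ * Complex.I) * z)
        (closedBall (0 : ℂ) 1) (closedBall 0 1) := by
      intro z hz
      simpa only [mem_closedBall_zero_iff, norm_mul, hnorm, one_mul] using hz
    have hcrot : ContinuousOn (fun z => ψ (Complex.exp (-θ * Complex.I) * z)) (closedBall 0 1) :=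
      hcont.comp (by fun_prop) hmaps
    have hwcl : w ∈ closedBall (0 : ℂ) 1 := sphere_subset_closedBall hw
    have hlim : ‖ψ w‖ * m ≤ M * ‖ψ (Complex.exp (-θ * Complex.I) * w)‖ :=
      ContinuousWithinAt.closure_le (s := ball (0 : ℂ) 1)
        (f := fun z => ‖ψ z‖ * m) (g := fun z => M * ‖ψ (Complex.exp (-θ * Complex.I) * z)‖)
        (by rwa [closure_ball 0 one_ne_zero])
        (((hcont.norm.mul continuousOn_const) w hwcl).mono ball_subset_closedBall)
        (((continuousOn_const.mul hcrot.norm) w hwcl).mono ball_subset_closedBall) hbound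
    rw [hrot, hψ₀, norm_zero, mul_zero] at hlim
    exact norm_le_zero_iff.mp (nonpos_of_mul_nonpos_left hlim hm)
end
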